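/- Let α = (α¹, …, αⁿ) be pairwise disjoint locally finite subsets of ℝ with two-sided densities 0 < ρ¹ < … < ρⁿ, and set η^k = D^{(n−k+1)}(α^k, α^{k+1}, …, αⁿ) for k = 1, …, n. Let x ∈ ℝ with x ∉ α¹ ∪ … ∪ αⁿ, let x^{n+1} = x and x^k = max(α^k ∩ (−∞, x^{k+1})) for k = n, …, 1, and let z^k = max(η^k ∩ (−∞, x)) for each k (all these maxima exist). Define the multi-line jump J(α,x) by J(α,x)^k = (α^k \ {x^k}) ∪ {x^{k+1}}. Then for every k = 1, …, n: D^{(n−k+1)}(J(α,x)^k, J(α,x)^{k+1}, …, J(α,x)^n) = (η^k \ {z^k}) ∪ {x}; that is, applying the multi-line jump at x and then the queueing map C equals applying C and then the simultaneous Hammersley jump at x on every line. -/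

import Mathlib

open Set Filter Classical

noncomputable section

/-- A subset of `ℝ` is locally finite if its intersection with every bounded interval
is finite. -/
def LocFin (B : Set ℝ) : Prop := ∀ a b : ℝ, (B ∩ Set.Icc a b).Finite

/-- The right-continuous random-walk function `Z` associated to arrivals `A` and services `S`:
`Z 0 = 0` and `Z s - Z r = |A ∩ (r,s]| - |S ∩ (r,s]|` for `r < s`;
`Z` jumps up by 1 at points of `A` and down by 1 at points of `S`. -/
def Zfun (A S : Set ℝ) (r : ℝ) : ℤ :=
  if 0 ≤ r then ((A ∩ Set.Ioc 0 r).ncard : ℤ) - ((S ∩ Set.Ioc 0 r).ncard : ℤ)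
  else ((S ∩ Set.Ioc r 0).ncard : ℤ) - ((A ∩ Set.Ioc r 0).ncard : ℤ)

/-- The pair `(A,S)` is admissible: both sets locally finite and disjoint, and
`Z_r → -∞` as `r → ∞`, `Z_r → +∞` as `r → -∞`. -/
def Admissible (A S : Set ℝ) : Prop :=
  LocFin A ∧ LocFin S ∧ Disjoint A S ∧
  Tendsto (Zfun A S) atTop atBot ∧ Tendsto (Zfun A S) atBot atTop

/-- Unused service times: times `r ∈ S` where `Z` attains a new record down, i.e.
`Z r < Z r'` for all `r' < r` (equivalently `Z_r < inf_{r' < r} Z_{r'}`). -/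
def Unused (A S : Set ℝ) : Set ℝ := {r ∈ S | ∀ r' < r, Zfun A S r < Zfun A S r'}

/-- Departure times: service times that are not unused. -/
def Dep (A S : Set ℝ) : Set ℝ := S \ Unused A S

/-- `B` has two-sided density `ρ`. -/
def HasDens (B : Set ℝ) (ρ : ℝ) : Prop :=
  Tendsto (fun s : ℝ => ((B ∩ Set.Icc 0 s).ncard : ℝ) / s) atTop (nhds ρ) ∧
  Tendsto (fun s : ℝ => ((B ∩ Set.Icc (-s) 0).ncard : ℝ) / s) atTop (nhds ρ)

/-- The queue length `Q_r = Z_r - min_{r' ≤ r} Z_{r'}`. -/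
def Qlen (A S : Set ℝ) (r : ℝ) : ℤ := Zfun A S r - sInf (Zfun A S '' Set.Iic r)

/-- `Dseq α k m = D^{(m+1)}(α_k, α_{k+1}, …, α_{k+m})`, the tandem departure operator:
`D^{(1)}(α¹) = α¹` and `D^{(n)}(α¹,…,αⁿ) = D(D^{(n-1)}(α¹,…,α^{n-1}), αⁿ)`. -/
def Dseq (α : ℕ → Set ℝ) (k : ℕ) : ℕ → Set ℝ
  | 0 => α k
  | m + 1 => Dep (Dseq α k m) (α (k + m + 1))

/-- signed counting function -/
def cnt (B : Set ℝ) (r : ℝ) : ℤ :=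
  if 0 ≤ r then ((B ∩ Set.Ioc 0 r).ncard : ℤ) else -((B ∩ Set.Ioc r 0).ncard : ℤ)

lemma Zfun_eq (A S : Set ℝ) (r : ℝ) : Zfun A S r = cnt A r - cnt S r := by
  unfold Zfun cnt
  split_ifs <;> ring

lemma LocFin.ioc {B : Set ℝ} (h : LocFin B) (a b : ℝ) : (B ∩ Set.Ioc a b).Finite :=
  (h a b).subset (Set.inter_subset_inter_right _ Set.Ioc_subset_Icc_self)

lemma LocFin.mono {A B : Set ℝ} (h : LocFin B) (hs : A ⊆ B) : LocFin A :=
  fun a b => (h a b).subset (Set.inter_subset_inter_left _ hs)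

lemma ncard_split {B : Set ℝ} (h : LocFin B) {a b c : ℝ} (hab : a ≤ b) (hbc : b ≤ c) :
    (B ∩ Set.Ioc a c).ncard = (B ∩ Set.Ioc a b).ncard + (B ∩ Set.Ioc b c).ncard := by
  rw [← Set.ncard_union_eq _ (h.ioc _ _) (h.ioc _ _), ← Set.inter_union_distrib_left,
    Set.Ioc_union_Ioc_eq_Ioc hab hbc]
  rw [Set.disjoint_left]
  rintro t ⟨_, h1⟩ ⟨_, h2⟩
  exact absurd h1.2 (not_le.2 h2.1)

lemma cnt_sub {B : Set ℝ} (h : LocFin B) {r s : ℝ} (hrs : r ≤ s) :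
    cnt B s = cnt B r + ((B ∩ Set.Ioc r s).ncard : ℤ) := by
  unfold cnt
  split_ifs with h1 h2 h2
  · have := ncard_split h h2 hrs
    omega
  · have := ncard_split h (le_of_not_ge h2) h1
    omega
  · exact absurd (h2.trans hrs) h1
  · have := ncard_split h hrs (le_of_not_ge h1)
    omega

lemma cnt_mono {B : Set ℝ} (h : LocFin B) {r s : ℝ} (hrs : r ≤ s) : cnt B r ≤ cnt B s := by
  rw [cnt_sub h hrs]; omega

lemma cnt_lt {B : Set ℝ} (h : LocFin B) {r s : ℝ} (hrs : r < s) (hs : s ∈ B) :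
    cnt B r + 1 ≤ cnt B s := by
  rw [cnt_sub h hrs.le]
  have : 0 < (B ∩ Set.Ioc r s).ncard :=
    (Set.ncard_pos (h.ioc _ _)).2 ⟨s, hs, hrs, le_rfl⟩
  omega

lemma cnt_const {B : Set ℝ} (h : LocFin B) {r s : ℝ} (hrs : r ≤ s)
    (he : ∀ t ∈ B, r < t → t ≤ s → False) : cnt B s = cnt B r := by
  rw [cnt_sub h hrs]
  have : B ∩ Set.Ioc r s = ∅ := by
    ext t; simp only [Set.mem_inter_iff, Set.mem_Ioc, Set.mem_empty_iff_false, iff_false]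
    rintro ⟨a, b, c⟩; exact he t a b c
  simp [this]

lemma cnt_one {B : Set ℝ} (h : LocFin B) {r s : ℝ} (hrs : r < s) (hs : s ∈ B)
    (he : ∀ t ∈ B, r < t → t < s → False) : cnt B s = cnt B r + 1 := by
  rw [cnt_sub h hrs.le]
  have : B ∩ Set.Ioc r s = {s} := by
    ext t; simp only [Set.mem_inter_iff, Set.mem_Ioc, Set.mem_singleton_iff]
    constructor
    · rintro ⟨a, b, c⟩
      rcases c.lt_or_eq with c | c
      · exact (he t a b c).elim
      · exact c
    · rintro rfl; exact ⟨hs, hrs, le_rfl⟩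
  simp [this]

lemma LocFin.insert {B : Set ℝ} (h : LocFin B) (a : ℝ) : LocFin (insert a B) := by
  intro u v
  refine ((h u v).insert a).subset ?_
  rintro t ⟨rfl | h1, h2⟩
  · exact Or.inl rfl
  · exact Or.inr ⟨h1, h2⟩

/-- Effect of inserting a point. -/
lemma cnt_insert {B : Set ℝ} (h : LocFin B) {a : ℝ} (ha : a ∉ B) :
    ∃ c : ℤ, ∀ r, cnt (insert a B) r = cnt B r + c + (if a ≤ r then 1 else 0) := by
  have h' := h.insert a
  refine ⟨cnt (insert a B) a - cnt B a - 1, fun r => ?_⟩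
  split_ifs with har
  · rw [cnt_sub h har, cnt_sub h' har]
    have : insert a B ∩ Set.Ioc a r = B ∩ Set.Ioc a r := by
      ext t
      simp only [Set.mem_inter_iff, Set.mem_insert_iff, Set.mem_Ioc]
      constructor
      · rintro ⟨rfl | h1, h2, h3⟩
        · exact absurd h2 (lt_irrefl _)
        · exact ⟨h1, h2, h3⟩
      · rintro ⟨h1, h2⟩; exact ⟨Or.inr h1, h2⟩
    rw [this]; ring
  · have hra : r < a := not_le.1 har
    rw [cnt_sub h hra.le, cnt_sub h' hra.le]
    have : insert a B ∩ Set.Ioc r a = insert a (B ∩ Set.Ioc r a) := by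
      ext t
      simp only [Set.mem_inter_iff, Set.mem_insert_iff, Set.mem_Ioc]
      constructor
      · rintro ⟨rfl | h1, h2⟩
        · exact Or.inl rfl
        · exact Or.inr ⟨h1, h2⟩
      · rintro (rfl | ⟨h1, h2⟩)
        · exact ⟨Or.inl rfl, hra, le_rfl⟩
        · exact ⟨Or.inr h1, h2⟩
    rw [this, Set.ncard_insert_of_notMem (fun hh => ha hh.1) (h.ioc _ _)]
    push_cast; ring

lemma exists_greatest {B : Set ℝ} (h : LocFin B) {t : ℝ} (hne : (B ∩ Set.Iio t).Nonempty) :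
    ∃ w, IsGreatest (B ∩ Set.Iio t) w := by
  obtain ⟨b, hb, hbt⟩ := hne
  have hf : (B ∩ Set.Iio t ∩ Set.Icc b t).Finite :=
    (h b t).subset (fun u hu => ⟨hu.1.1, hu.2⟩)
  obtain ⟨w, hw, hmax⟩ := hf.exists_maximalFor id _ ⟨b, ⟨hb, hbt⟩, le_rfl, le_of_lt hbt⟩
  refine ⟨w, hw.1, fun u hu => ?_⟩
  rcases le_total u w with h1 | h1
  · exact h1
  · exact hmax (j := u) ⟨hu, hw.2.1.trans h1, le_of_lt hu.2⟩ h1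

lemma exists_gap {B : Set ℝ} (h : LocFin B) (t l : ℝ) (hl : l < t) :
    ∃ p < t, l ≤ p ∧ ∀ u ∈ B, p < u → u < t → False := by
  by_cases hne : (B ∩ Set.Iio t).Nonempty
  · obtain ⟨w, hw, hm⟩ := exists_greatest h hne
    refine ⟨max w l, max_lt hw.2 hl, le_max_right _ _, fun u hu h1 h2 => ?_⟩
    exact absurd (hm ⟨hu, h2⟩) (not_le.2 ((le_max_left _ _).trans_lt h1))
  · exact ⟨l, hl, le_rfl, fun u hu _ h2 => hne ⟨u, hu, h2⟩⟩

lemma mem_Dep {A S : Set ℝ} {r : ℝ} :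
    r ∈ Dep A S ↔ r ∈ S ∧ ∃ r' < r, Zfun A S r' ≤ Zfun A S r := by
  unfold Dep Unused
  simp only [Set.mem_sdiff, Set.mem_ofPred_eq, not_and, not_forall, not_lt]
  constructor
  · rintro ⟨h, h2⟩
    obtain ⟨a, b, c⟩ := h2 h
    exact ⟨h, a, b, c⟩
  · rintro ⟨h, a, b, c⟩
    exact ⟨h, fun _ => ⟨a, b, c⟩⟩

/-- bounded below on left half-lines -/
def BB (A S : Set ℝ) : Prop := ∀ t : ℝ, ∃ m : ℤ, ∀ r < t, m ≤ Zfun A S r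

lemma Z_shift {A S : Set ℝ} (hA : LocFin A) (hS : LocFin S) {x y z : ℝ}
    (hzA : z ∈ A) (hyA : y ∉ A) (hyS : y ∈ S) (hxS : x ∉ S) :
    ∃ c : ℤ, ∀ r, Zfun ((A \ {z}) ∪ {y}) ((S \ {y}) ∪ {x}) r =
      Zfun A S r + c + (if y ≤ r then 2 else 0) - (if z ≤ r then 1 else 0)
        - (if x ≤ r then 1 else 0) := by
  have hA0 : LocFin (A \ {z}) := hA.mono Set.sdiff_subset
  have hS0 : LocFin (S \ {y}) := hS.mono Set.sdiff_subset
  obtain ⟨c1, h1⟩ := cnt_insert hA0 (a := z) (by simp)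
  obtain ⟨c2, h2⟩ := cnt_insert hA0 (a := y) (fun h => hyA h.1)
  obtain ⟨c3, h3⟩ := cnt_insert hS0 (a := y) (by simp)
  obtain ⟨c4, h4⟩ := cnt_insert hS0 (a := x) (fun h => hxS h.1)
  rw [Set.insert_sdiff_singleton, Set.insert_eq_of_mem hzA] at h1
  rw [Set.insert_sdiff_singleton, Set.insert_eq_of_mem hyS] at h3
  refine ⟨c2 - c1 - c4 + c3, fun r => ?_⟩
  rw [Zfun_eq, Zfun_eq, Set.union_singleton, Set.union_singleton, h1, h2, h3, h4]
  split_ifs <;> ring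

lemma two_line {A S : Set ℝ} (hA : LocFin A) (hS : LocFin S) (hd : Disjoint A S)
    (hbb : BB A S) {x y z : ℝ} (hxA : x ∉ A) (hxS : x ∉ S)
    (hy : IsGreatest (S ∩ Set.Iio x) y) (hz : IsGreatest (A ∩ Set.Iio y) z) :
    ∃ w, IsGreatest (Dep A S ∩ Set.Iio x) w ∧
      Dep ((A \ {z}) ∪ {y}) ((S \ {y}) ∪ {x}) = (Dep A S \ {w}) ∪ {x} := by
  obtain ⟨⟨hyS, hyx⟩, hymax⟩ := hy
  obtain ⟨⟨hzA, hzy⟩, hzmax⟩ := hz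
  simp only [Set.mem_Iio] at hyx hzy
  have hyA : y ∉ A := fun h => Set.disjoint_left.1 hd h hyS
  have hzS : z ∉ S := fun h => Set.disjoint_left.1 hd hzA h
  have noA : ∀ t ∈ A, z < t → t ≤ y → False := by
    intro t ht h1 h2
    have : t < y := lt_of_le_of_ne h2 (fun h => hyA (h ▸ ht))
    exact absurd (hzmax ⟨ht, this⟩) (not_le.2 h1)
  have noS : ∀ t ∈ S, y < t → t ≤ x → False := by
    intro t ht h1 h2
    have : t < x := lt_of_le_of_ne h2 (fun h => hxS (h ▸ ht))
    exact absurd (hymax ⟨ht, this⟩) (not_le.2 h1)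
  obtain ⟨c, hZ'⟩ := Z_shift hA hS hzA hyA hyS hxS
  have h1 : ∀ r s, z ≤ r → r ≤ s → s ≤ y → Zfun A S s ≤ Zfun A S r := by
    intro r s a b d
    rw [Zfun_eq, Zfun_eq, cnt_const hA b (fun t ht u v => noA t ht (a.trans_lt u) (v.trans d))]
    have := cnt_mono hS b
    omega
  have h2 : ∀ r ∈ S, ∀ p, z ≤ p → p < r → r ≤ y → Zfun A S r + 1 ≤ Zfun A S p := by
    intro r hr p a b d
    rw [Zfun_eq, Zfun_eq, cnt_const hA b.le (fun t ht u v => noA t ht (a.trans_lt u) (v.trans d))]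
    have := cnt_lt hS b hr
    omega
  have h5 : ∀ r, y ≤ r → r ≤ x → Zfun A S y ≤ Zfun A S r := by
    intro r a b
    rw [Zfun_eq, Zfun_eq, cnt_const hS a (fun t ht u v => noS t ht u (v.trans b))]
    have := cnt_mono hA a
    omega
  obtain ⟨r0, hr0, h3⟩ : ∃ r0 < z, ∀ r < z, Zfun A S r0 ≤ Zfun A S r := by
    obtain ⟨m, hm⟩ := hbb z
    obtain ⟨v, ⟨r0, hr0, rfl⟩, hl⟩ := Int.exists_least_of_bdd
      (P := fun v => ∃ r0 < z, Zfun A S r0 = v)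
      ⟨m, by rintro v ⟨r, hr, rfl⟩; exact hm r hr⟩ ⟨_, z - 1, by linarith, rfl⟩
    exact ⟨r0, hr0, fun r hr => hl _ ⟨r, hr, rfl⟩⟩
  have h4 : Zfun A S r0 + 1 ≤ Zfun A S z := by
    obtain ⟨p, hp, -, hgap⟩ := exists_gap hS z (z - 1) (by linarith)
    have e := h3 p hp
    have e2 := cnt_lt hA hp hzA
    have e3 := cnt_const hS hp.le (fun t ht u v => hgap t ht u
      (lt_of_le_of_ne v (fun h => hzS (h ▸ ht))))
    rw [Zfun_eq A S z]; rw [Zfun_eq A S p] at e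
    omega
  obtain ⟨q, hqy, hzq, hq⟩ : ∃ q < y, z ≤ q ∧ Zfun A S q ≤ Zfun A S y + 1 := by
    obtain ⟨p, hp, hzp, hgap⟩ := exists_gap hS y z hzy
    refine ⟨p, hp, hzp, ?_⟩
    rw [Zfun_eq, Zfun_eq, cnt_one hS hp hyS hgap]
    have := cnt_mono hA hp.le
    omega
  have cS : ∀ r ∈ S, r ≠ y → r < z ∨ (z < r ∧ r < y) ∨ x < r := by
    intro r hr hry
    rcases lt_trichotomy r z with h | h | h
    · exact Or.inl h
    · exact absurd (h ▸ hr) hzS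
    · rcases lt_or_gt_of_ne hry with h' | h'
      · exact Or.inr (Or.inl ⟨h, h'⟩)
      · exact Or.inr (Or.inr (not_le.1 (fun h'' => noS r hr h' h'')))
  -- values of the shifted function
  have v1 : ∀ r, r < z → Zfun ((A \ {z}) ∪ {y}) ((S \ {y}) ∪ {x}) r = Zfun A S r + c := by
    intro r hr
    rw [hZ', if_neg (by linarith), if_neg (by linarith), if_neg (by linarith)]; ring
  have v2 : ∀ r, z ≤ r → r < y →
      Zfun ((A \ {z}) ∪ {y}) ((S \ {y}) ∪ {x}) r = Zfun A S r + c - 1 := by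
    intro r hr hr'
    rw [hZ', if_neg (by linarith), if_pos (by linarith), if_neg (by linarith)]; ring
  have v3 : ∀ r, y ≤ r → r < x →
      Zfun ((A \ {z}) ∪ {y}) ((S \ {y}) ∪ {x}) r = Zfun A S r + c + 1 := by
    intro r hr hr'
    rw [hZ', if_pos (by linarith), if_pos (by linarith), if_neg (by linarith)]; ring
  have v4 : ∀ r, x ≤ r → Zfun ((A \ {z}) ∪ {y}) ((S \ {y}) ∪ {x}) r = Zfun A S r + c := by
    intro r hr
    rw [hZ', if_pos (by linarith), if_pos (by linarith), if_pos (by linarith)]; ring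
  by_cases hcase : Zfun A S r0 ≤ Zfun A S y
  · refine ⟨y, ⟨⟨mem_Dep.2 ⟨hyS, r0, hr0.trans hzy, hcase⟩, hyx⟩, fun r hr =>
      hymax ⟨(mem_Dep.1 hr.1).1, hr.2⟩⟩, ?_⟩
    ext r
    by_cases hrx : r = x
    · subst hrx
      refine iff_of_true (mem_Dep.2 ⟨Or.inr rfl, r0, by linarith, ?_⟩) (Or.inr rfl)
      rw [v1 _ hr0, v4 _ le_rfl]
      have := h5 r hyx.le le_rfl
      omega
    have hrhs : r ∈ Dep A S \ {y} ∪ {x} ↔ (r ∈ S ∧ r ≠ y) ∧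
        ∃ r' < r, Zfun A S r' ≤ Zfun A S r := by
      simp only [Set.mem_union, Set.mem_sdiff, Set.mem_singleton_iff, hrx, or_false, mem_Dep]
      tauto
    rw [hrhs, mem_Dep]
    have hS' : r ∈ S \ {y} ∪ {x} ↔ r ∈ S ∧ r ≠ y := by
      simp [hrx]
    rw [hS']
    refine and_congr_right ?_
    rintro ⟨hrS, hry⟩
    rcases cS r hrS hry with h | ⟨h, h'⟩ | h
    · refine exists_congr fun r' => and_congr_right fun hr' => ?_
      rw [v1 _ (hr'.trans h), v1 _ h]; omega
    · have e := h2 y hyS r h.le h' le_rfl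
      refine iff_of_true ⟨r0, hr0.trans h, ?_⟩ ⟨r0, hr0.trans h, by omega⟩
      rw [v1 _ hr0, v2 _ h.le h']; omega
    · rw [v4 r h.le]
      by_cases hM : Zfun A S r0 ≤ Zfun A S r
      · refine iff_of_true ⟨r0, by linarith, ?_⟩ ⟨r0, by linarith, by omega⟩
        rw [v1 _ hr0]; omega
      · refine exists_congr fun r' => and_congr_right fun hr' => ?_
        rcases lt_or_ge r' z with a | a
        · rw [v1 _ a]; omega
        rcases lt_or_ge r' y with b | b
        · rw [v2 _ a b]
          have := h2 y hyS r' a b le_rfl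
          omega
        rcases lt_or_ge r' x with d | d
        · rw [v3 _ b d]
          have := h5 r' b d.le
          omega
        · rw [v4 _ d]; omega
  · obtain ⟨w, hwS, hzw, hwy, hw⟩ : ∃ w ∈ S, z < w ∧ w < y ∧ Zfun A S w = Zfun A S r0 := by
      have hf : {r | (r = z ∨ r ∈ S) ∧ z ≤ r ∧ r < y ∧ Zfun A S r0 ≤ Zfun A S r}.Finite := by
        refine ((hS z y).insert z).subset ?_
        rintro r ⟨rfl | h, a, b, -⟩
        · exact Or.inl rfl
        · exact Or.inr ⟨h, a, b.le⟩
      obtain ⟨p, ⟨hp1, hp2, hp3, hp4⟩, hmax⟩ := hf.exists_maximalFor id _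
        ⟨z, Or.inl rfl, le_rfl, hzy, by omega⟩
      have hf2 : (S ∩ Set.Ioc p y).Finite := hS.ioc _ _
      obtain ⟨u, ⟨huS, hpu, huy⟩, hmin⟩ := hf2.exists_minimalFor id _ ⟨y, hyS, hp3, le_rfl⟩
      have hu : Zfun A S u = Zfun A S p - 1 := by
        rw [Zfun_eq, Zfun_eq, cnt_const hA hpu.le
          (fun t ht a b => noA t ht (hp2.trans_lt a) (b.trans huy)), cnt_one hS hpu huS]
        · ring
        · intro t ht a b
          exact absurd (hmin (j := t) ⟨ht, a, b.le.trans huy⟩ b.le) (not_le.2 b)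
      have hlt : Zfun A S u < Zfun A S r0 := by
        by_contra hcon
        have huy' : u < y := lt_of_le_of_ne huy (fun h => by subst h; omega)
        exact absurd (hmax (j := u) ⟨Or.inr huS, hp2.trans hpu.le, huy', by omega⟩ hpu.le)
          (not_le.2 hpu)
      rcases hp1 with rfl | hp1
      · omega
      · exact ⟨p, hp1, lt_of_le_of_ne hp2 (fun h => hzS (h ▸ hp1)), hp3, by omega⟩
    have nodep : ∀ r ∈ S, w < r → r ≤ y → ∀ r' < r, Zfun A S r < Zfun A S r' := by
      intro r hr a b r' hr'
      rcases lt_or_ge r' z with d | d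
      · have := h3 r' d
        have := h2 r hr w hzw.le a b
        omega
      · have := h2 r hr r' d hr' b
        omega
    refine ⟨w, ⟨⟨mem_Dep.2 ⟨hwS, r0, hr0.trans hzw, by omega⟩, hwy.trans hyx⟩, ?_⟩, ?_⟩
    · rintro r ⟨hr, hrx⟩
      obtain ⟨hrS, r', hr', hle⟩ := mem_Dep.1 hr
      by_contra hcon
      have := nodep r hrS (not_le.1 hcon) (hymax ⟨hrS, hrx⟩) r' hr'
      omega
    ext r
    by_cases hrx : r = x
    · subst hrx
      refine iff_of_true (mem_Dep.2 ⟨Or.inr rfl, q, by linarith, ?_⟩) (Or.inr rfl)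
      rw [v2 _ hzq hqy, v4 _ le_rfl]
      have := h5 r hyx.le le_rfl
      omega
    have hrhs : r ∈ Dep A S \ {w} ∪ {x} ↔ (r ∈ S ∧ r ≠ y) ∧ (r ≠ w ∧
        ∃ r' < r, Zfun A S r' ≤ Zfun A S r) := by
      simp only [Set.mem_union, Set.mem_sdiff, Set.mem_singleton_iff, hrx, or_false, mem_Dep]
      constructor
      · rintro ⟨⟨a, r', b, d⟩, e⟩
        refine ⟨⟨a, ?_⟩, e, r', b, d⟩
        rintro rfl
        have := nodep r hyS hwy le_rfl r' b
        omega
      · tauto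
    rw [hrhs, mem_Dep]
    have hS' : r ∈ S \ {y} ∪ {x} ↔ r ∈ S ∧ r ≠ y := by
      simp [hrx]
    rw [hS']
    refine and_congr_right ?_
    rintro ⟨hrS, hry⟩
    rcases cS r hrS hry with h | ⟨h, h'⟩ | h
    · rw [and_iff_right (by rintro rfl; linarith)]
      refine exists_congr fun r' => and_congr_right fun hr' => ?_
      rw [v1 _ (hr'.trans h), v1 _ h]; omega
    · rw [v2 r h.le h']
      rcases lt_or_ge r w with hw1 | hw1
      · have e := h2 w hwS r h.le hw1 hwy.le
        refine iff_of_true ⟨r0, hr0.trans h, ?_⟩ ⟨hw1.ne, r0, hr0.trans h, by omega⟩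
        rw [v1 _ hr0]; omega
      · have hrw : Zfun A S r ≤ Zfun A S w := h1 w r hzw.le hw1 h'.le
        refine iff_of_false ?_ ?_
        · rintro ⟨r', hr', hle⟩
          rcases lt_or_ge r' z with d | d
          · rw [v1 _ d] at hle
            have := h3 r' d
            omega
          · rw [v2 _ d (hr'.trans h')] at hle
            have := h2 r hrS r' d hr' h'.le
            omega
        · rintro ⟨hne, r', hr', hle⟩
          have := nodep r hrS (lt_of_le_of_ne hw1 (Ne.symm hne)) h'.le r' hr'
          omega
    · rw [and_iff_right (by rintro rfl; linarith), v4 r h.le]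
      by_cases hM : Zfun A S y ≤ Zfun A S r
      · refine iff_of_true ⟨q, by linarith, ?_⟩ ⟨y, by linarith, by omega⟩
        rw [v2 _ hzq hqy]; omega
      · refine exists_congr fun r' => and_congr_right fun hr' => ?_
        rcases lt_or_ge r' z with a | a
        · rw [v1 _ a]; omega
        rcases lt_or_ge r' y with b | b
        · rw [v2 _ a b]
          have := h2 y hyS r' a b le_rfl
          omega
        rcases lt_or_ge r' x with d | d
        · rw [v3 _ b d]
          have := h5 r' b d.le
          omega
        · rw [v4 _ d]; omega

lemma dens_nonempty {B : Set ℝ} {ρ : ℝ} (hB : LocFin B) (hd : HasDens B ρ) (hρ : 0 < ρ) (t : ℝ) :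
    (B ∩ Set.Iio t).Nonempty := by
  by_contra hne
  have hle : ∀ s : ℝ, ((B ∩ Set.Icc (-s) 0).ncard : ℝ) ≤ ((B ∩ Set.Icc t 0).ncard : ℝ) := by
    intro s
    have hsub : B ∩ Set.Icc (-s) 0 ⊆ B ∩ Set.Icc t 0 := fun u hu =>
      ⟨hu.1, not_lt.1 (fun h => hne ⟨u, hu.1, h⟩), hu.2.2⟩
    exact_mod_cast Set.ncard_le_ncard hsub (hB _ _)
  have hlim : Tendsto (fun s : ℝ => ((B ∩ Set.Icc t 0).ncard : ℝ) / s) atTop (nhds 0) :=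
    tendsto_const_nhds.div_atTop tendsto_id
  have := le_of_tendsto_of_tendsto hd.2 hlim (by
    filter_upwards [eventually_gt_atTop 0] with s hs
    exact div_le_div_of_nonneg_right (hle s) hs.le)
  linarith

lemma dens_BB {A B S : Set ℝ} {ρ σ : ℝ} (hAB : A ⊆ B) (hB : LocFin B) (hS : LocFin S)
    (hdB : HasDens B ρ) (hdS : HasDens S σ) (h : ρ < σ) : BB A S := by
  have hA := hB.mono hAB
  have hev : ∀ᶠ s : ℝ in atTop, ((B ∩ Set.Icc (-s) 0).ncard : ℝ) / s <
      ((S ∩ Set.Icc (-s) 0).ncard : ℝ) / s := hdB.2.eventually_lt hdS.2 h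
  obtain ⟨R, hR⟩ := eventually_atTop.1 (hev.and (eventually_gt_atTop 0))
  have key : ∀ r ≤ -R, -1 ≤ Zfun A S r := by
    intro r hr
    obtain ⟨h1, h2⟩ := hR (-r) (by linarith)
    rw [div_lt_div_iff_of_pos_right h2, neg_neg] at h1
    have h1' : (B ∩ Set.Icc r 0).ncard < (S ∩ Set.Icc r 0).ncard := by exact_mod_cast h1
    unfold Zfun
    rw [if_neg (by linarith)]
    have e1 : (A ∩ Set.Ioc r 0).ncard ≤ (B ∩ Set.Icc r 0).ncard :=
      Set.ncard_le_ncard (Set.inter_subset_inter hAB Set.Ioc_subset_Icc_self) (hB _ _)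
    have e2 : (S ∩ Set.Icc r 0).ncard ≤ (S ∩ Set.Ioc r 0).ncard + 1 := by
      refine (Set.ncard_le_ncard (t := insert r (S ∩ Set.Ioc r 0)) ?_
        ((hS.ioc _ _).insert _)).trans (Set.ncard_insert_le _ _)
      rintro u ⟨hu, ha, hb⟩
      rcases ha.eq_or_lt with ha | ha
      · exact Or.inl ha.symm
      · exact Or.inr ⟨hu, ha, hb⟩
    omega
  intro t
  refine ⟨min (-1) (cnt A (-R) - cnt S t), fun r hr => ?_⟩
  rcases le_total r (-R) with h1 | h1
  · exact (min_le_left _ _).trans (key r h1)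
  · refine (min_le_right _ _).trans ?_
    rw [Zfun_eq]
    have := cnt_mono hA h1
    have := cnt_mono hS hr.le
    omega

/-- iterated jump positions -/
def gpos (n : ℕ) (α : ℕ → Set ℝ) (x : ℝ) : ℕ → ℝ
  | 0 => x
  | i + 1 => sSup (α (n - i) ∩ Set.Iio (gpos n α x i))

lemma Dseq_subset (α : ℕ → Set ℝ) (k m : ℕ) : Dseq α k m ⊆ α (k + m) := by
  cases m with
  | zero => exact subset_rfl
  | succ m => exact Set.sdiff_subset

/-- intertwining of the queueing map `C` with the multi-line jump, general case.
With `η^k = D^{(n-k+1)}(α^k,…,αⁿ) = Dseq α k (n-k)`, `x ∉ α¹ ∪ … ∪ αⁿ`, jump positions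
`x^{n+1} = x`, `x^k = max(α^k ∩ (-∞, x^{k+1}))`, and `z^k = max(η^k ∩ (-∞,x))`
(all these maxima exist), the multi-line jump `J(α,x)^k = (α^k \ {x^k}) ∪ {x^{k+1}}`
satisfies, for every `k = 1,…,n`:
`D^{(n-k+1)}(J(α,x)^k, …, J(α,x)^n) = (η^k \ {z^k}) ∪ {x}`. -/
theorem queue_intertwines_jump (n : ℕ) (hn : 1 ≤ n) (α : ℕ → Set ℝ) (ρ : ℕ → ℝ)
    (hlf : ∀ k, 1 ≤ k → k ≤ n → LocFin (α k))
    (hdisj : ∀ k l, 1 ≤ k → k < l → l ≤ n → Disjoint (α k) (α l))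
    (hdens : ∀ k, 1 ≤ k → k ≤ n → HasDens (α k) (ρ k))
    (hpos : 0 < ρ 1)
    (hmono : ∀ k, 1 ≤ k → k < n → ρ k < ρ (k + 1))
    (x : ℝ) (hx : ∀ k, 1 ≤ k → k ≤ n → x ∉ α k) :
    ∃ xs : ℕ → ℝ, xs (n + 1) = x ∧
      (∀ k, 1 ≤ k → k ≤ n → IsGreatest (α k ∩ Set.Iio (xs (k + 1))) (xs k)) ∧
      ∃ zs : ℕ → ℝ,
        (∀ k, 1 ≤ k → k ≤ n → IsGreatest (Dseq α k (n - k) ∩ Set.Iio x) (zs k)) ∧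
        (∀ k, 1 ≤ k → k ≤ n →
          Dseq (fun j => (α j \ {xs j}) ∪ {xs (j + 1)}) k (n - k) =
            (Dseq α k (n - k) \ {zs k}) ∪ {x}) := by
  have hρpos : ∀ k, 1 ≤ k → k ≤ n → 0 < ρ k := by
    intro k hk
    induction k, hk using Nat.le_induction with
    | base => intro _; exact hpos
    | succ k hk ih => intro h; exact (ih (by omega)).trans (hmono k hk (by omega))
  let xs : ℕ → ℝ := fun k => gpos n α x (n + 1 - k)
  have hxs0 : xs (n + 1) = x := by simp [xs, gpos]
  have hxs : ∀ k, 1 ≤ k → k ≤ n → IsGreatest (α k ∩ Set.Iio (xs (k + 1))) (xs k) := by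
    intro k hk hkn
    obtain ⟨w, hw⟩ := exists_greatest (hlf k hk hkn)
      (dens_nonempty (hlf k hk hkn) (hdens k hk hkn) (hρpos k hk hkn) (xs (k + 1)))
    have : xs k = w := by
      have e1 : n + 1 - k = (n - k) + 1 := by omega
      have e2 : n + 1 - (k + 1) = n - k := by omega
      have e3 : n - (n - k) = k := by omega
      simp only [xs, e2] at hw
      simp only [xs, e1, gpos, e3]
      exact hw.csSup_eq
    rw [this]; exact hw
  have hxs_not : ∀ j k, 1 ≤ j → j < k → k ≤ n + 1 → xs k ∉ α j := by
    intro j k hj hjk hk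
    rcases hk.eq_or_lt with rfl | hk
    · rw [hxs0]; exact hx j hj (by omega)
    · have h1 := (hxs k (by omega) (by omega)).1.1
      exact fun h => Set.disjoint_left.1 (hdisj j k hj hjk (by omega)) h h1
  have main : ∀ k m, 1 ≤ k → k + m ≤ n →
      ∃ w, IsGreatest (Dseq α k m ∩ Set.Iio (xs (k + m + 1))) w ∧
        Dseq (fun j => (α j \ {xs j}) ∪ {xs (j + 1)}) k m =
          (Dseq α k m \ {w}) ∪ {xs (k + m + 1)} := by
    intro k m hk
    induction m with
    | zero => intro h; exact ⟨xs k, hxs k hk h, rfl⟩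
    | succ m ih =>
      intro h
      obtain ⟨z, hz, heq⟩ := ih (by omega)
      have hsub := Dseq_subset α k m
      have hB := hlf (k + m) (by omega) (by omega)
      have hS := hlf (k + m + 1) (by omega) (by omega)
      have := two_line (hB.mono hsub) hS
        ((hdisj (k + m) (k + m + 1) (by omega) (by omega) (by omega)).mono_left hsub)
        (dens_BB hsub hB hS (hdens _ (by omega) (by omega)) (hdens _ (by omega) (by omega))
          (hmono _ (by omega) (by omega)))
        (x := xs (k + m + 1 + 1))
        (fun hh => hxs_not (k + m) (k + m + 1 + 1) (by omega) (by omega) (by omega) (hsub hh))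
        (hxs_not (k + m + 1) (k + m + 1 + 1) (by omega) (by omega) (by omega))
        (hxs (k + m + 1) (by omega) (by omega)) hz
      obtain ⟨w, hw1, hw2⟩ := this
      refine ⟨w, hw1, ?_⟩
      rw [← heq] at hw2
      exact hw2
  have main2 : ∀ k, ∃ w, 1 ≤ k → k ≤ n → IsGreatest (Dseq α k (n - k) ∩ Set.Iio x) w ∧
        Dseq (fun j => (α j \ {xs j}) ∪ {xs (j + 1)}) k (n - k) =
          (Dseq α k (n - k) \ {w}) ∪ {x} := by
    intro k
    by_cases hk : 1 ≤ k ∧ k ≤ n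
    · obtain ⟨w, hw⟩ := main k (n - k) hk.1 (by omega)
      have e : k + (n - k) + 1 = n + 1 := by omega
      rw [e, hxs0] at hw
      exact ⟨w, fun _ _ => hw⟩
    · exact ⟨0, fun a b => absurd ⟨a, b⟩ hk⟩
  choose zs hzs using main2
  exact ⟨xs, hxs0, hxs, zs, fun k a b => (hzs k a b).1, fun k a b => (hzs k a b).2⟩
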